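/- arXiv:1507.02772 — 2 statements merged into one kernel-verified Lean document; each statement's English description precedes it below -/
import Mathlib

section
/- Let B, C, X be fixed d×d symmetric positive definite matrices and set S = X^{-1/2}. Define f(x) = ‖Log(S(xB+C)S)‖_F² for real x such that xB + C is positive definite. Then the derivative of f is f'(x) = 2·trace(Log(S(xB+C)S) · S^{-1} (xB+C)^{-1} B S). -/
open Matrix

noncomputable def mlog {d : ℕ} (A : Matrix (Fin d) (Fin d) ℝ) : Matrix (Fin d) (Fin d) ℝ :=
  cfc Real.log A

noncomputable def msqrt {d : ℕ} (A : Matrix (Fin d) (Fin d) ℝ) : Matrix (Fin d) (Fin d) ℝ :=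
  cfc Real.sqrt A

noncomputable def fnorm {d : ℕ} (A : Matrix (Fin d) (Fin d) ℝ) : ℝ :=
  Real.sqrt (Matrix.trace (Aᵀ * A))

noncomputable def riemDist {d : ℕ} (X Y : Matrix (Fin d) (Fin d) ℝ) : ℝ :=
  fnorm (mlog ((msqrt X)⁻¹ * Y * (msqrt X)⁻¹))

section TraceFunctionalCalculus

variable {n : Type*} [Fintype n] [DecidableEq n]

lemma Matrix.continuousOn_spectrum (f : ℝ → ℝ) (A : Matrix n n ℝ) :
    ContinuousOn f (spectrum ℝ A) := by
  rw [continuousOn_iff_continuous_domRestrict]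
  have := A.finite_real_spectrum
  fun_prop

lemma Matrix.cfc_fun_mul (f g : ℝ → ℝ) (A : Matrix n n ℝ) :
    cfc (fun u => f u * g u) A = cfc f A * cfc g A :=
  cfc_mul f g A (A.continuousOn_spectrum f) (A.continuousOn_spectrum g)

/-- Traces of products of functions of two Hermitian matrices, expressed through the overlaps of
their eigenvectors. -/
lemma Matrix.IsHermitian.exists_trace_cfc_mul_cfc {A A' : Matrix n n ℝ}
    (hA : A.IsHermitian) (hA' : A'.IsHermitian) :
    ∃ w : n → n → ℝ, (∀ i j, 0 ≤ w i j) ∧ (∀ j, ∑ i, w i j = 1) ∧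
      ∀ f g : ℝ → ℝ, (cfc f A * cfc g A').trace =
        ∑ i, ∑ j, w i j * (f (hA.eigenvalues i) * g (hA'.eigenvalues j)) := by
  set U : Matrix n n ℝ := ↑hA.eigenvectorUnitary with hU
  set V : Matrix n n ℝ := ↑hA'.eigenvectorUnitary with hV
  have hUU : U * star U = 1 := Unitary.coe_mul_star_self hA.eigenvectorUnitary
  have hVV : star V * V = 1 := Unitary.coe_star_mul_self hA'.eigenvectorUnitary
  set W : Matrix n n ℝ := star U * V with hW
  refine ⟨fun i j => W i j ^ 2, fun i j => sq_nonneg _, fun j => ?_, fun f g => ?_⟩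
  · have h : star W * W = 1 := by
      rw [hW, star_mul, star_star, mul_assoc, ← mul_assoc U, hUU, one_mul, hVV]
    have h' := congrFun (congrFun h j) j
    simpa [Matrix.mul_apply, Matrix.star_apply, sq] using h'
  · rw [hA.cfc_eq, hA'.cfc_eq, Matrix.IsHermitian.cfc, Matrix.IsHermitian.cfc,
      Unitary.conjStarAlgAut_apply, Unitary.conjStarAlgAut_apply]
    set D : Matrix n n ℝ := diagonal (RCLike.ofReal ∘ f ∘ hA.eigenvalues) with hD
    set E : Matrix n n ℝ := diagonal (RCLike.ofReal ∘ g ∘ hA'.eigenvalues) with hE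
    have h : (U * D * star U * (V * E * star V)).trace = (D * W * (E * star W)).trace := by
      rw [hW, star_mul, star_star, mul_assoc U, mul_assoc U, trace_mul_comm U]
      simp only [mul_assoc]
    refine h.trans ?_
    simp only [Matrix.trace, Matrix.diag, Matrix.mul_apply (M := D * W)]
    refine Finset.sum_congr rfl fun i _ => Finset.sum_congr rfl fun j _ => ?_
    rw [hD, hE, Matrix.diagonal_mul, Matrix.diagonal_mul, Matrix.star_apply]
    simp
    ring

/-- Every eigenvalue of `A'` is within the Frobenius distance of `A` and `A'` of some eigenvalue
of `A`, and a quadratic bound on the first order Taylor remainder of `g` at the eigenvalues bounds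
the first order Taylor remainder of `trace ∘ cfc g`. -/
lemma Matrix.IsHermitian.trace_cfc_perturbation {A A' : Matrix n n ℝ}
    (hA : A.IsHermitian) (hA' : A'.IsHermitian) :
    (∀ j, ∃ i, (hA'.eigenvalues j - hA.eigenvalues i) ^ 2 ≤ ((A' - A) * (A' - A)).trace) ∧
    ∀ (g g' : ℝ → ℝ) (K : ℝ),
      (∀ i j, |g (hA'.eigenvalues j) - g (hA.eigenvalues i) -
          g' (hA.eigenvalues i) * (hA'.eigenvalues j - hA.eigenvalues i)| ≤
        K * (hA'.eigenvalues j - hA.eigenvalues i) ^ 2) →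
      |(cfc g A').trace - (cfc g A).trace - (cfc g' A * (A' - A)).trace| ≤
        K * ((A' - A) * (A' - A)).trace := by
  obtain ⟨w, hw, hw1, hT⟩ := hA.exists_trace_cfc_mul_cfc hA'
  have one_left : ∀ g : ℝ → ℝ, (cfc g A').trace =
      ∑ i, ∑ j, w i j * (1 * g (hA'.eigenvalues j)) := fun g => by
    rw [← hT (fun _ => 1) g, cfc_const_one ℝ A hA.isSelfAdjoint, one_mul]
  have one_right : ∀ g : ℝ → ℝ, (cfc g A).trace =
      ∑ i, ∑ j, w i j * (g (hA.eigenvalues i) * 1) := fun g => by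
    rw [← hT g (fun _ => 1), cfc_const_one ℝ A' hA'.isSelfAdjoint, mul_one]
  have id_right : ∀ g : ℝ → ℝ, (cfc g A * A').trace =
      ∑ i, ∑ j, w i j * (g (hA.eigenvalues i) * hA'.eigenvalues j) := fun g => by
    rw [← hT g (fun u => u), cfc_id' ℝ A' hA'.isSelfAdjoint]
  have mul_self : ∀ g : ℝ → ℝ, (cfc g A * A).trace =
      ∑ i, ∑ j, w i j * (g (hA.eigenvalues i) * hA.eigenvalues i * 1) := fun g => by
    rw [← one_right (fun u => g u * u), Matrix.cfc_fun_mul, cfc_id' ℝ A hA.isSelfAdjoint]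
  have hsq : ((A' - A) * (A' - A)).trace =
      ∑ i, ∑ j, w i j * (hA'.eigenvalues j - hA.eigenvalues i) ^ 2 := by
    have h1 := one_left (fun u => u * u)
    have h2 := mul_self (fun u => u)
    have h3 := id_right (fun u => u)
    rw [Matrix.cfc_fun_mul, cfc_id' ℝ A' hA'.isSelfAdjoint] at h1
    rw [cfc_id' ℝ A hA.isSelfAdjoint] at h2 h3
    have h4 : ((A' - A) * (A' - A)).trace =
        (A' * A').trace + (A * A).trace - 2 * (A * A').trace := by
      rw [sub_mul, mul_sub, mul_sub, trace_sub, trace_sub, trace_sub, trace_mul_comm A' A]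
      ring
    rw [h4, h1, h2, h3]
    simp only [Finset.mul_sum, ← Finset.sum_add_distrib, ← Finset.sum_sub_distrib]
    exact Finset.sum_congr rfl fun i _ => Finset.sum_congr rfl fun j _ => by ring
  refine ⟨fun j => ?_, fun g g' K hK => ?_⟩
  · by_contra! h
    have hlt : ∑ i, w i j * ((A' - A) * (A' - A)).trace <
        ∑ i, w i j * (hA'.eigenvalues j - hA.eigenvalues i) ^ 2 := by
      refine Finset.sum_lt_sum
        (fun i _ => mul_le_mul_of_nonneg_left (h i).le (hw i j)) ?_
      obtain ⟨i, -, hi⟩ := Finset.exists_ne_zero_of_sum_ne_zero ((hw1 j).trans_ne one_ne_zero)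
      exact ⟨i, Finset.mem_univ i, mul_lt_mul_of_pos_left (h i) ((hw i j).lt_of_ne' hi)⟩
    rw [← Finset.sum_mul, hw1, one_mul, hsq] at hlt
    refine hlt.not_ge (Finset.sum_le_sum fun i _ => ?_)
    exact Finset.single_le_sum
      (f := fun j => w i j * (hA'.eigenvalues j - hA.eigenvalues i) ^ 2)
      (fun k _ => mul_nonneg (hw i k) (sq_nonneg _)) (Finset.mem_univ j)
  · have h : (cfc g A').trace - (cfc g A).trace - (cfc g' A * (A' - A)).trace =
        ∑ i, ∑ j, w i j * (g (hA'.eigenvalues j) - g (hA.eigenvalues i) -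
          g' (hA.eigenvalues i) * (hA'.eigenvalues j - hA.eigenvalues i)) := by
      rw [mul_sub, trace_sub, one_left, one_right, id_right, mul_self]
      simp only [← Finset.sum_sub_distrib]
      exact Finset.sum_congr rfl fun i _ => Finset.sum_congr rfl fun j _ => by ring
    rw [h, hsq, Finset.mul_sum]
    refine (Finset.abs_sum_le_sum_abs _ _).trans (Finset.sum_le_sum fun i _ => ?_)
    rw [Finset.mul_sum]
    refine (Finset.abs_sum_le_sum_abs _ _).trans (Finset.sum_le_sum fun j _ => ?_)
    rw [abs_mul, abs_of_nonneg (hw i j), mul_left_comm]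
    exact mul_le_mul_of_nonneg_left (hK i j) (hw i j)

end TraceFunctionalCalculus

lemma abs_taylor_remainder_le {g g' : ℝ → ℝ} {s : Set ℝ} {K : ℝ} (hs : Convex ℝ s)
    (hg : ∀ u ∈ s, HasDerivAt g (g' u) u)
    (hK : ∀ u ∈ s, ∀ v ∈ s, |g' u - g' v| ≤ K * |u - v|) (hK0 : 0 ≤ K) :
    ∀ u ∈ s, ∀ v ∈ s, |g v - g u - g' u * (v - u)| ≤ K * (v - u) ^ 2 := by
  intro u hu v hv
  have hsub : segment ℝ u v ⊆ s := hs.segment_subset hu hv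
  have h := (convex_segment u v).norm_image_sub_le_of_norm_hasDerivWithin_le
    (f := fun y => g y - g' u * y) (f' := fun y => g' y - g' u) (C := K * |v - u|)
    (fun y hy =>
      ((hg y (hsub hy)).sub (hasDerivAt_const_mul (g' u))).hasDerivWithinAt)
    (fun y hy => (hK y (hsub hy) u hu).trans <| mul_le_mul_of_nonneg_left
      (Set.abs_sub_left_of_mem_uIcc (segment_eq_uIcc u v ▸ hy)) hK0)
    (left_mem_segment ℝ u v) (right_mem_segment ℝ u v)
  rw [Real.norm_eq_abs, Real.norm_eq_abs, mul_assoc, abs_mul_abs_self, ← sq] at h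
  convert h using 2
  ring

lemma exists_abs_sub_le_mul_of_contDiffOn {f : ℝ → ℝ} (hf : ContDiffOn ℝ 1 f (Set.Ioi 0))
    {a b : ℝ} (ha : 0 < a) :
    ∃ K, 0 ≤ K ∧ ∀ u ∈ Set.Icc a b, ∀ v ∈ Set.Icc a b, |f u - f v| ≤ K * |u - v| := by
  have hsub : Set.Icc a b ⊆ Set.Ioi 0 := fun u hu => ha.trans_le hu.1
  have hd : ∀ u ∈ Set.Icc a b, HasDerivAt f (deriv f u) u := fun u hu =>
    ((hf.differentiableOn one_ne_zero).differentiableAt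
      (isOpen_Ioi.mem_nhds (hsub hu))).hasDerivAt
  have hc : ContinuousOn (deriv f) (Set.Icc a b) :=
    (hf.continuousOn_deriv_of_isOpen isOpen_Ioi le_rfl).mono hsub
  obtain ⟨K, hK⟩ := isCompact_Icc.exists_bound_of_continuousOn hc
  refine ⟨max K 0, le_max_right _ _, fun u hu v hv => ?_⟩
  exact (convex_Icc a b).norm_image_sub_le_of_norm_hasDerivWithin_le
    (fun y hy => (hd y hy).hasDerivWithinAt) (fun y hy => (hK y hy).trans (le_max_left _ _)) hv hu

lemma Matrix.PosDef.exists_eigenvalues_mem_Icc {n : Type*} [Fintype n] [DecidableEq n]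
    {A : Matrix n n ℝ} (hA : A.PosDef) :
    ∃ a > 0, ∃ b, ∀ i, hA.1.eigenvalues i ∈ Set.Icc (2 * a) b := by
  have h : ∀ᶠ a : ℝ in nhdsWithin 0 (Set.Ioi 0), ∀ i, 2 * a ≤ hA.1.eigenvalues i := by
    refine Filter.eventually_all.2 fun i => ?_
    filter_upwards [Ioo_mem_nhdsGT (half_pos (hA.eigenvalues_pos i))] with a ha
    linarith [ha.2]
  obtain ⟨a, ha, ha0⟩ := (h.and self_mem_nhdsWithin).exists
  refine ⟨a, ha0, ∑ i, hA.1.eigenvalues i, fun i => ⟨ha i, ?_⟩⟩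
  exact Finset.single_le_sum (fun j _ => (hA.eigenvalues_pos j).le) (Finset.mem_univ i)

/-- The derivative of `trace ∘ cfc g` along a line of symmetric matrices. -/
theorem Matrix.PosDef.hasDerivAt_trace_cfc {n : Type*} [Fintype n] [DecidableEq n]
    {A H : Matrix n n ℝ} (hA : A.PosDef) (hH : H.IsHermitian) {g g' : ℝ → ℝ}
    (hg : ∀ u > 0, HasDerivAt g (g' u) u) (hg' : ContDiffOn ℝ 1 g' (Set.Ioi 0)) (x : ℝ) :
    HasDerivAt (fun t : ℝ => (cfc g (A + (t - x) • H)).trace) ((cfc g' A * H).trace) x := by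
  obtain ⟨a, ha, b, hab⟩ := hA.exists_eigenvalues_mem_Icc
  obtain ⟨K, hK0, hK⟩ := exists_abs_sub_le_mul_of_contDiffOn hg' (b := b + a) ha
  have hrem := abs_taylor_remainder_le (convex_Icc a (b + a))
    (fun u hu => hg u (ha.trans_le hu.1)) hK hK0
  rw [hasDerivAt_iff_isLittleO]
  have hlittle : (fun t : ℝ => (t - x) ^ 2) =o[nhds x] fun t => t - x := by
    simpa using Asymptotics.isLittleO_pow_sub_sub x (one_lt_two)
  refine Asymptotics.IsBigO.trans_isLittleO
    (Asymptotics.IsBigO.of_bound (K * (H * H).trace) ?_) hlittle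
  have hsmall : ∀ᶠ t in nhds x, (t - x) ^ 2 * (H * H).trace < a ^ 2 := by
    have hc : Continuous fun t : ℝ => (t - x) ^ 2 * (H * H).trace := by fun_prop
    exact hc.continuousAt.eventually_lt_const (by simpa using pow_pos ha 2)
  filter_upwards [hsmall] with t ht
  have hA' : (A + (t - x) • H).IsHermitian := hA.1.add (hH.smul (IsSelfAdjoint.all _))
  have hsub : A + (t - x) • H - A = (t - x) • H := add_sub_cancel_left _ _
  have htr : (((t - x) • H) * ((t - x) • H)).trace = (t - x) ^ 2 * (H * H).trace := by
    simp only [smul_mul_assoc, mul_smul_comm, trace_smul, smul_eq_mul]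
    ring
  obtain ⟨hclose, hbound⟩ := hA.1.trace_cfc_perturbation hA'
  rw [hsub, htr] at hclose
  have hmem : ∀ j, hA'.eigenvalues j ∈ Set.Icc a (b + a) := fun j => by
    obtain ⟨i, hi⟩ := hclose j
    have := abs_le_of_sq_le_sq' (hi.trans ht.le) ha.le
    obtain ⟨h1, h2⟩ := hab i
    constructor <;> linarith [this.1, this.2]
  have := hbound g g' K fun i j =>
    hrem _ ⟨by linarith [(hab i).1], by linarith [(hab i).2]⟩ _ (hmem j)
  rw [hsub, htr, mul_smul_comm, trace_smul] at this
  rw [sub_self, zero_smul, add_zero, Real.norm_eq_abs, Real.norm_eq_abs,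
    abs_of_nonneg (sq_nonneg (t - x)), mul_assoc, mul_comm (H * H).trace]
  exact this

lemma fnorm_mlog_sq {d : ℕ} (A : Matrix (Fin d) (Fin d) ℝ) :
    fnorm (mlog A) ^ 2 = (cfc (fun u => Real.log u * Real.log u) A).trace := by
  have hsa : (cfc Real.log A)ᵀ = cfc Real.log A := by
    simpa [IsSelfAdjoint, star_eq_conjTranspose] using cfc_predicate Real.log A
  have hnonneg : 0 ≤ ((mlog A)ᵀ * mlog A).trace := by
    simpa using (Matrix.posSemidef_conjTranspose_mul_self (mlog A)).trace_nonneg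
  rw [fnorm, Real.sq_sqrt hnonneg, Matrix.cfc_fun_mul, mlog, hsa]

lemma msqrt_mul_self {d : ℕ} {X : Matrix (Fin d) (Fin d) ℝ} (hX : X.PosSemidef) :
    msqrt X * msqrt X = X := by
  rw [msqrt, ← Matrix.cfc_fun_mul]
  conv_rhs => rw [← cfc_id' ℝ X hX.1.isSelfAdjoint]
  refine cfc_congr fun u hu => Real.mul_self_sqrt ?_
  rw [hX.1.spectrum_real_eq_range_eigenvalues] at hu
  obtain ⟨i, rfl⟩ := hu
  exact hX.eigenvalues_nonneg i

lemma Matrix.PosDef.cfc_log_sq_deriv {n : Type*} [Fintype n] [DecidableEq n]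
    {A : Matrix n n ℝ} (hA : A.PosDef) :
    cfc (fun u => 2 * Real.log u * u⁻¹) A = (2 : ℝ) • (cfc Real.log A * A⁻¹) := by
  have hdet : IsUnit A.det := (Matrix.isUnit_iff_isUnit_det A).1 hA.isUnit
  have h : cfc (fun u => 2 * Real.log u * u⁻¹) A * A = (2 : ℝ) • cfc Real.log A := by
    rw [← cfc_const_mul (2 : ℝ) Real.log A (A.continuousOn_spectrum _)]
    nth_rw 2 [← cfc_id' ℝ A hA.1.isSelfAdjoint]
    rw [← Matrix.cfc_fun_mul]
    refine cfc_congr fun u hu => ?_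
    rw [hA.1.spectrum_real_eq_range_eigenvalues] at hu
    obtain ⟨i, rfl⟩ := hu
    exact inv_mul_cancel_right₀ (hA.eigenvalues_pos i).ne' _
  rw [← smul_mul_assoc, ← h, Matrix.mul_nonsing_inv_cancel_right _ _ hdet]

theorem stmt_2 {d : ℕ} (B C X : Matrix (Fin d) (Fin d) ℝ)
    (hB : B.PosDef) (hC : C.PosDef) (hX : X.PosDef) (x : ℝ)
    (hx : (x • B + C).PosDef) :
    HasDerivAt
      (fun t : ℝ => (fnorm (mlog ((msqrt X)⁻¹ * (t • B + C) * (msqrt X)⁻¹)))^2)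
      (2 * Matrix.trace (mlog ((msqrt X)⁻¹ * (x • B + C) * (msqrt X)⁻¹) *
        ((msqrt X)⁻¹)⁻¹ * (x • B + C)⁻¹ * B * (msqrt X)⁻¹)) x := by
  set S := (msqrt X)⁻¹ with hS
  have hdet : IsUnit (msqrt X).det := by
    have := (Matrix.isUnit_iff_isUnit_det X).1 hX.isUnit
    rw [← msqrt_mul_self hX.posSemidef, Matrix.det_mul] at this
    exact isUnit_of_mul_isUnit_left this
  have hSdet : IsUnit S.det := Matrix.isUnit_nonsing_inv_det _ hdet
  have hSH : Sᴴ = S := by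
    have : (msqrt X).IsHermitian := cfc_predicate Real.sqrt X
    exact this.inv
  set A := S * (x • B + C) * S with hA
  have hApos : A.PosDef := by
    have := hx.conjTranspose_mul_mul_same
      (Matrix.mulVec_injective_of_isUnit ((Matrix.isUnit_iff_isUnit_det S).2 hSdet))
    rwa [hSH] at this
  have hH : (S * B * S).IsHermitian := by
    have := Matrix.isHermitian_conjTranspose_mul_mul S hB.1
    rwa [hSH] at this
  have hline : ∀ t : ℝ, S * (t • B + C) * S = A + (t - x) • (S * B * S) := fun t => by
    simp only [hA, mul_add, add_mul, mul_smul_comm, smul_mul_assoc, sub_smul]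
    abel
  have hg : ∀ u > (0 : ℝ),
      HasDerivAt (fun u => Real.log u * Real.log u) (2 * Real.log u * u⁻¹) u := fun u hu => by
    have h := Real.hasDerivAt_log hu.ne'
    exact (h.mul h).congr_deriv (by ring)
  have hg' : ContDiffOn ℝ 1 (fun u : ℝ => 2 * Real.log u * u⁻¹) (Set.Ioi 0) := fun u hu =>
    have hu0 : u ≠ 0 := (Set.mem_Ioi.1 hu).ne'
    ((contDiffAt_const.mul (Real.contDiffAt_log.2 hu0)).mul
      (contDiffAt_inv ℝ hu0)).contDiffWithinAt
  simp only [hline, fnorm_mlog_sq]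
  refine (hApos.hasDerivAt_trace_cfc hH hg hg' x).congr_deriv ?_
  have hAinv : A⁻¹ * (S * B * S) = S⁻¹ * (x • B + C)⁻¹ * B * S := by
    rw [hA, Matrix.mul_inv_rev, Matrix.mul_inv_rev]
    simp only [mul_assoc, Matrix.nonsing_inv_mul_cancel_left _ _ hSdet]
  rw [hApos.cfc_log_sq_deriv, smul_mul_assoc, Matrix.trace_smul, smul_eq_mul, mul_assoc, hAinv,
    mlog]
  simp only [mul_assoc]
end

section
/- Let Θ(D) = ½ trace(Log(Z M Z)²) where Z is a fixed symmetric positive definite matrix and M = Σᵢ αᵢ Aᵢ is a positive definite combination of symmetric positive definite matrices Aᵢ with coefficients αᵢ ≥ 0. Then the Euclidean gradient of Θ with respect to the atom Aᵢ is ∇_{Aᵢ}Θ = αᵢ Z Log(ZMZ)(ZMZ)^{-1} Z, i.e., the directional derivative of Θ at Aᵢ in a symmetric direction E equals αᵢ trace(Log(ZMZ)(ZMZ)^{-1} Z E Z). -/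
open Matrix

open Filter Topology

namespace Matrix

variable {m : Type*} [Fintype m] [DecidableEq m]

lemma continuousOn_spectrum_real (f : ℝ → ℝ) (X : Matrix m m ℝ) :
    ContinuousOn f (spectrum ℝ X) :=
  X.finite_real_spectrum.continuousOn f

namespace IsHermitian

variable {X Y : Matrix m m ℝ} (hX : X.IsHermitian) (hY : Y.IsHermitian)

/-- The squared inner product of the `i`-th eigenvector of `X` with the `j`-th one of `Y`. -/
noncomputable def overlap (i j : m) : ℝ :=
  (star (hX.eigenvectorUnitary : Matrix m m ℝ) * (hY.eigenvectorUnitary : Matrix m m ℝ)) i j ^ 2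

lemma overlap_nonneg (i j : m) : 0 ≤ hX.overlap hY i j := sq_nonneg _

lemma sum_overlap (j : m) : ∑ i, hX.overlap hY i j = 1 := by
  set W := star (hX.eigenvectorUnitary : Matrix m m ℝ) *
    (hY.eigenvectorUnitary : Matrix m m ℝ) with hW
  have h : star W * W = 1 := by
    rw [hW, star_mul, star_star, mul_assoc, ← mul_assoc _ (star _) _,
      Unitary.mul_star_self_of_mem hX.eigenvectorUnitary.2, one_mul,
      Unitary.star_mul_self_of_mem hY.eigenvectorUnitary.2]
  have := congrFun (congrFun h j) j
  rw [mul_apply, one_apply_eq] at this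
  rw [← this]
  refine Finset.sum_congr rfl fun i _ => ?_
  rw [overlap, ← hW, star_apply, star_trivial, sq]

lemma trace_cfc_mul_cfc (g h : ℝ → ℝ) :
    trace (cfc g X * cfc h Y) =
      ∑ i, ∑ j, g (hX.eigenvalues i) * h (hY.eigenvalues j) * hX.overlap hY i j := by
  rw [hX.cfc_eq, hY.cfc_eq, IsHermitian.cfc, IsHermitian.cfc, Unitary.conjStarAlgAut_apply,
    Unitary.conjStarAlgAut_apply]
  simp only [overlap]
  set U := (hX.eigenvectorUnitary : Matrix m m ℝ)
  set V := (hY.eigenvectorUnitary : Matrix m m ℝ)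
  set W := star U * V with hW
  have hW' : star V * U = star W := by rw [hW, star_mul, star_star]
  rw [mul_assoc U, mul_assoc U, trace_mul_comm U]
  have : ∀ D D' : Matrix m m ℝ,
      D * star U * (V * D' * star V) * U = D * W * (D' * star W) := by
    intro D D'
    rw [← hW', hW]
    simp only [mul_assoc]
  rw [this, trace]
  refine Finset.sum_congr rfl fun i _ => ?_
  rw [diag_apply, mul_apply]
  refine Finset.sum_congr rfl fun j _ => ?_
  rw [diagonal_mul, diagonal_mul, star_apply, star_trivial]
  simp only [Function.comp_apply, RCLike.ofReal_real_eq_id, id_eq]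
  ring

lemma trace_cfc_eq_sum_overlap (g : ℝ → ℝ) :
    trace (cfc g X) = ∑ i, ∑ j, g (hX.eigenvalues i) * hX.overlap hY i j := by
  simpa [cfc_const_one ℝ Y hY.isSelfAdjoint] using hX.trace_cfc_mul_cfc hY g (fun _ => 1)

lemma trace_cfc_eq_sum_overlap' (h : ℝ → ℝ) :
    trace (cfc h Y) = ∑ i, ∑ j, h (hY.eigenvalues j) * hX.overlap hY i j := by
  simpa [cfc_const_one ℝ X hX.isSelfAdjoint] using hX.trace_cfc_mul_cfc hY (fun _ => 1) h

lemma trace_sub_sq :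
    trace ((Y - X) ^ 2) =
      ∑ i, ∑ j, (hY.eigenvalues j - hX.eigenvalues i) ^ 2 * hX.overlap hY i j := by
  have h1 := hX.trace_cfc_mul_cfc hY id id
  have h2 := hX.trace_cfc_eq_sum_overlap hY (fun x => x ^ 2)
  have h3 := hX.trace_cfc_eq_sum_overlap' hY (fun x => x ^ 2)
  rw [cfc_id ℝ X hX.isSelfAdjoint, cfc_id ℝ Y hY.isSelfAdjoint] at h1
  rw [cfc_pow_id X 2 hX.isSelfAdjoint] at h2
  rw [cfc_pow_id Y 2 hY.isSelfAdjoint] at h3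
  have : trace ((Y - X) ^ 2) = trace (Y ^ 2) - 2 * trace (X * Y) + trace (X ^ 2) := by
    rw [sq, sub_mul, mul_sub, mul_sub, trace_sub, trace_sub, trace_sub, trace_mul_comm Y X, sq, sq]
    ring
  rw [this, h1, h2, h3, Finset.mul_sum, ← Finset.sum_sub_distrib, ← Finset.sum_add_distrib]
  refine Finset.sum_congr rfl fun i _ => ?_
  rw [Finset.mul_sum, ← Finset.sum_sub_distrib, ← Finset.sum_add_distrib]
  refine Finset.sum_congr rfl fun j _ => ?_
  simp only [id]
  ring

lemma trace_cfc_sub_linearization (f f' : ℝ → ℝ) :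
    trace (cfc f Y) - trace (cfc f X) - trace (cfc f' X * (Y - X)) =
      ∑ i, ∑ j, (f (hY.eigenvalues j) - f (hX.eigenvalues i) -
        f' (hX.eigenvalues i) * (hY.eigenvalues j - hX.eigenvalues i)) *
          hX.overlap hY i j := by
  have h1 := hX.trace_cfc_mul_cfc hY f' id
  have h2 := hX.trace_cfc_eq_sum_overlap hY (fun x => f' x * id x)
  rw [cfc_mul f' id X (continuousOn_spectrum_real _ _) (continuousOn_spectrum_real _ _),
    cfc_id ℝ X hX.isSelfAdjoint] at h2
  rw [cfc_id ℝ Y hY.isSelfAdjoint] at h1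
  rw [mul_sub, trace_sub, h1, h2, hX.trace_cfc_eq_sum_overlap hY f,
    hX.trace_cfc_eq_sum_overlap' hY f]
  simp only [← Finset.sum_sub_distrib]
  refine Finset.sum_congr rfl fun i _ => Finset.sum_congr rfl fun j _ => ?_
  simp only [id]
  ring

/-- Every eigenvalue of `Y` lies within the Frobenius distance of `X` and `Y` of some
eigenvalue of `X`. -/
lemma exists_abs_eigenvalues_sub_le (j : m) :
    ∃ i, |hY.eigenvalues j - hX.eigenvalues i| ≤ √(trace ((Y - X) ^ 2)) := by
  by_contra! hcon
  have hsum := hX.sum_overlap hY j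
  have hsq (i : m) : trace ((Y - X) ^ 2) < (hY.eigenvalues j - hX.eigenvalues i) ^ 2 := by
    rw [← sq_abs (hY.eigenvalues j - hX.eigenvalues i)]
    exact (Real.sqrt_lt' ((Real.sqrt_nonneg _).trans_lt (hcon i))).1 (hcon i)
  have hlt : ∑ i, trace ((Y - X) ^ 2) * hX.overlap hY i j <
      ∑ i, (hY.eigenvalues j - hX.eigenvalues i) ^ 2 * hX.overlap hY i j := by
    obtain ⟨k, -, hk⟩ := Finset.exists_ne_zero_of_sum_ne_zero (hsum.trans_ne one_ne_zero)
    exact Finset.sum_lt_sum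
      (fun i _ => mul_le_mul_of_nonneg_right (hsq i).le (hX.overlap_nonneg hY i j))
      ⟨k, Finset.mem_univ k, mul_lt_mul_of_pos_right (hsq k)
        ((hX.overlap_nonneg hY k j).lt_of_ne' hk)⟩
  rw [← Finset.mul_sum, hsum, mul_one, hX.trace_sub_sq hY] at hlt
  refine hlt.not_ge (Finset.sum_le_sum fun i _ => ?_)
  exact Finset.single_le_sum (f := fun j => (hY.eigenvalues j - hX.eigenvalues i) ^ 2 *
      hX.overlap hY i j)
    (fun j _ => mul_nonneg (sq_nonneg _) (hX.overlap_nonneg hY i j)) (Finset.mem_univ j)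

lemma abs_trace_cfc_sub_linearization_le {f f' : ℝ → ℝ} {C : ℝ}
    (hC : ∀ i j, |f (hY.eigenvalues j) - f (hX.eigenvalues i) -
        f' (hX.eigenvalues i) * (hY.eigenvalues j - hX.eigenvalues i)| ≤
      C * (hY.eigenvalues j - hX.eigenvalues i) ^ 2) :
    |trace (cfc f Y) - trace (cfc f X) - trace (cfc f' X * (Y - X))| ≤
      C * trace ((Y - X) ^ 2) := by
  rw [hX.trace_cfc_sub_linearization hY, hX.trace_sub_sq hY, Finset.mul_sum]
  refine (Finset.abs_sum_le_sum_abs _ _).trans (Finset.sum_le_sum fun i _ => ?_)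
  rw [Finset.mul_sum]
  refine (Finset.abs_sum_le_sum_abs _ _).trans (Finset.sum_le_sum fun j _ => ?_)
  rw [abs_mul, abs_of_nonneg (hX.overlap_nonneg hY i j), ← mul_assoc]
  exact mul_le_mul_of_nonneg_right (hC i j) (hX.overlap_nonneg hY i j)

/-- The derivative of a trace function along a line of symmetric matrices. -/
theorem hasDerivAt_trace_cfc {H : Matrix m m ℝ} (hH : H.IsHermitian) {f f' : ℝ → ℝ} {a b C : ℝ}
    (hab : ∀ i, hX.eigenvalues i ∈ Set.Ioo a b)
    (hC : ∀ x ∈ Set.Icc a b, ∀ y ∈ Set.Icc a b,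
      |f y - f x - f' x * (y - x)| ≤ C * (y - x) ^ 2) :
    HasDerivAt (fun t : ℝ => trace (cfc f (X + t • H))) (trace (cfc f' X * H)) 0 := by
  have hsmall : ∀ᶠ t : ℝ in 𝓝 0, ∀ i,
      a < hX.eigenvalues i - √(trace ((t • H) ^ 2)) ∧
        hX.eigenvalues i + √(trace ((t • H) ^ 2)) < b := by
    have hs : Tendsto (fun t : ℝ => √(trace ((t • H) ^ 2))) (𝓝 0) (𝓝 0) := by
      have : Continuous fun t : ℝ => √(trace ((t • H) ^ 2)) := by
        simp only [smul_pow, trace_smul, smul_eq_mul]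
        fun_prop
      simpa using this.tendsto 0
    refine eventually_all.2 fun i => ?_
    have h1 := (hs.const_sub (hX.eigenvalues i)).eventually_const_lt
      (by simpa using (hab i).1 : a < _)
    have h2 := (hs.const_add (hX.eigenvalues i)).eventually_lt_const
      (by simpa using (hab i).2 : _ < b)
    exact h1.and h2
  rw [hasDerivAt_iff_isLittleO]
  refine Asymptotics.IsBigO.trans_isLittleO (g := fun t : ℝ => t ^ 2) ?_ ?_
  · refine Asymptotics.IsBigO.of_bound (C * trace (H ^ 2)) ?_
    filter_upwards [hsmall] with t ht
    have hY : (X + t • H).IsHermitian := hX.add (hH.smul (IsSelfAdjoint.all t))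
    have hmem (j : m) : hY.eigenvalues j ∈ Set.Icc a b := by
      obtain ⟨i, hi⟩ := hX.exists_abs_eigenvalues_sub_le hY j
      rw [add_sub_cancel_left, abs_le] at hi
      have := ht i
      constructor <;> linarith
    have key := hX.abs_trace_cfc_sub_linearization_le hY (f := f) (f' := f') (C := C)
      fun i j => hC _ (Set.Ioo_subset_Icc_self (hab i)) _ (hmem j)
    rw [add_sub_cancel_left, smul_pow, mul_smul_comm, trace_smul, trace_smul, smul_eq_mul,
      smul_eq_mul] at key
    rw [Real.norm_eq_abs, Real.norm_eq_abs, abs_of_nonneg (sq_nonneg t), zero_smul, add_zero,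
      sub_zero, smul_eq_mul]
    linarith
  · simpa using Asymptotics.isLittleO_pow_id (𝕜 := ℝ) one_lt_two

end IsHermitian

end Matrix

/-- First-order Taylor estimate on an interval, uniform in the base point. -/
lemma exists_abs_sub_linearization_le {f f' f'' : ℝ → ℝ} {a b : ℝ}
    (hf : ∀ x ∈ Set.Icc a b, HasDerivAt f (f' x) x)
    (hf' : ∀ x ∈ Set.Icc a b, HasDerivAt f' (f'' x) x)
    (hf'' : ContinuousOn f'' (Set.Icc a b)) :
    ∃ C, ∀ x ∈ Set.Icc a b, ∀ y ∈ Set.Icc a b,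
      |f y - f x - f' x * (y - x)| ≤ C * (y - x) ^ 2 := by
  obtain ⟨C, hC⟩ := isCompact_Icc.exists_bound_of_continuousOn hf''
  refine ⟨C, fun x hx y hy => ?_⟩
  have hC0 : 0 ≤ C := (norm_nonneg _).trans (hC x hx)
  have hsub : Set.uIcc x y ⊆ Set.Icc a b := Set.uIcc_subset_Icc hx hy
  have hlip : ∀ z ∈ Set.uIcc x y, ‖f' z - f' x‖ ≤ C * |y - x| := fun z hz =>
    ((convex_Icc a b).norm_image_sub_le_of_norm_hasDerivWithin_le
      (fun w hw => (hf' w hw).hasDerivWithinAt) hC hx (hsub hz)).trans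
      (mul_le_mul_of_nonneg_left (Set.abs_sub_left_of_mem_uIcc hz) hC0)
  have key := (convex_uIcc x y).norm_image_sub_le_of_norm_hasDerivWithin_le
    (f := fun z => f z - f' x * z) (f' := fun z => f' z - f' x)
    (fun z hz => by
      have h := (hf z (hsub hz)).sub ((hasDerivAt_id z).const_mul (f' x))
      rw [mul_one] at h
      exact h.hasDerivWithinAt)
    hlip Set.left_mem_uIcc Set.right_mem_uIcc
  rw [Real.norm_eq_abs, Real.norm_eq_abs] at key
  calc |f y - f x - f' x * (y - x)| = |f y - f' x * y - (f x - f' x * x)| := by ring_nf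
    _ ≤ C * |y - x| * |y - x| := key
    _ = C * (y - x) ^ 2 := by rw [mul_assoc, ← sq, sq_abs]

lemma exists_abs_log_sq_sub_linearization_le {a b : ℝ} (ha : 0 < a) :
    ∃ C, ∀ x ∈ Set.Icc a b, ∀ y ∈ Set.Icc a b,
      |Real.log y ^ 2 - Real.log x ^ 2 - 2 * (Real.log x * x⁻¹) * (y - x)| ≤
        C * (y - x) ^ 2 := by
  have hpos : ∀ x ∈ Set.Icc a b, x ≠ 0 := fun x hx => (ha.trans_le hx.1).ne'
  refine exists_abs_sub_linearization_le (f := fun x => Real.log x ^ 2)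
    (f' := fun x => 2 * (Real.log x * x⁻¹))
    (f'' := fun x => 2 * (x⁻¹ * x⁻¹ + Real.log x * (-(x ^ 2)⁻¹))) ?_ ?_ ?_
  · intro x hx
    have h := (Real.hasDerivAt_log (hpos x hx)).pow 2
    rwa [pow_one, Nat.cast_two, mul_assoc] at h
  · intro x hx
    exact ((Real.hasDerivAt_log (hpos x hx)).mul (hasDerivAt_inv (hpos x hx))).const_mul 2
  · have hlog : ContinuousOn Real.log (Set.Icc a b) := Real.continuousOn_log.mono hpos
    have hinv : ContinuousOn (fun x : ℝ => x⁻¹) (Set.Icc a b) := continuousOn_inv₀.mono hpos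
    have hinv' : ContinuousOn (fun x : ℝ => (x ^ 2)⁻¹) (Set.Icc a b) :=
      (continuousOn_pow 2).inv₀ fun x hx => pow_ne_zero 2 (hpos x hx)
    exact ((hinv.mul hinv).add (hlog.mul hinv'.neg)).const_smul (2 : ℝ)

lemma Matrix.PosDef.cfc_inv_eq {m : Type*} [Fintype m] [DecidableEq m] {P : Matrix m m ℝ}
    (hP : P.PosDef) : cfc (fun x : ℝ => x⁻¹) P = P⁻¹ := by
  symm
  apply Matrix.inv_eq_right_inv
  have h := cfc_mul id (fun x : ℝ => x⁻¹) P (continuousOn_spectrum_real _ _)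
    (continuousOn_spectrum_real _ _)
  rw [cfc_id ℝ P hP.1.isSelfAdjoint] at h
  rw [← h, ← cfc_const_one ℝ P hP.1.isSelfAdjoint]
  refine cfc_congr fun x hx => ?_
  rw [hP.1.spectrum_real_eq_range_eigenvalues] at hx
  obtain ⟨i, rfl⟩ := hx
  exact mul_inv_cancel₀ (hP.eigenvalues_pos i).ne'

theorem hasDerivAt_trace_mlog_sq {d : ℕ} {P H : Matrix (Fin d) (Fin d) ℝ} (hP : P.PosDef)
    (hH : H.IsHermitian) :
    HasDerivAt (fun t : ℝ => Matrix.trace (mlog (P + t • H) ^ 2))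
      (2 * Matrix.trace (mlog P * P⁻¹ * H)) 0 := by
  obtain ⟨r, hr, hr0⟩ : ∃ r : ℝ, (∀ i, hP.1.eigenvalues i ∈ Set.Ioo r r⁻¹) ∧ 0 < r := by
    have h : ∀ᶠ r : ℝ in 𝓝[>] 0, ∀ i, hP.1.eigenvalues i ∈ Set.Ioo r r⁻¹ :=
      eventually_all.2 fun i =>
        ((eventually_lt_nhds (hP.eigenvalues_pos i)).filter_mono nhdsWithin_le_nhds).and
          (tendsto_inv_nhdsGT_zero.eventually_gt_atTop _)
    exact (h.and self_mem_nhdsWithin).exists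
  obtain ⟨C, hC⟩ := exists_abs_log_sq_sub_linearization_le (b := r⁻¹) hr0
  have key := hP.1.hasDerivAt_trace_cfc hH (f := fun x => Real.log x ^ 2)
    (f' := fun x => 2 * (Real.log x * x⁻¹)) hr hC
  have hcfc : cfc (fun x : ℝ => 2 * (Real.log x * x⁻¹)) P = (2 : ℝ) • (mlog P * P⁻¹) := by
    rw [cfc_const_mul (2 : ℝ) _ P (continuousOn_spectrum_real _ _),
      cfc_mul _ _ P (continuousOn_spectrum_real _ _) (continuousOn_spectrum_real _ _),
      hP.cfc_inv_eq, mlog]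
  rw [hcfc, smul_mul_assoc, Matrix.trace_smul, smul_eq_mul] at key
  refine key.congr_of_eventuallyEq (Eventually.of_forall fun t => ?_)
  have hY : (P + t • H).IsHermitian := hP.1.add (hH.smul (IsSelfAdjoint.all t))
  simp only [mlog]
  rw [cfc_pow _ 2 _ (continuousOn_spectrum_real _ _) hY.isSelfAdjoint]

theorem stmt_16 {d n : ℕ} (Z : Matrix (Fin d) (Fin d) ℝ) (hZ : Z.PosDef)
    (A : Fin n → Matrix (Fin d) (Fin d) ℝ) (hA : ∀ j, (A j).PosDef)
    (α : Fin n → ℝ) (hα : ∀ j, 0 ≤ α j)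
    (hM : (∑ j, α j • A j).PosDef)
    (i : Fin n) (E : Matrix (Fin d) (Fin d) ℝ) (hE : E.IsSymm) :
    HasDerivAt
      (fun t : ℝ => (1/2) * Matrix.trace
        ((mlog (Z * ((∑ j, α j • A j) + (t * α i) • E) * Z))^2))
      (α i * Matrix.trace (mlog (Z * (∑ j, α j • A j) * Z) *
        (Z * (∑ j, α j • A j) * Z)⁻¹ * Z * E * Z)) 0 := by
  set M := ∑ j, α j • A j
  have hZM : (Z * M * Z).PosDef := by
    simpa only [hZ.1.eq] using hM.mul_mul_conjTranspose_same
      (B := Z) (Matrix.vecMul_injective_of_isUnit hZ.isUnit)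
  have hE' : E.IsHermitian := by
    rw [Matrix.IsHermitian, Matrix.conjTranspose_eq_transpose_of_trivial]
    exact hE
  have hH : (α i • (Z * E * Z)).IsHermitian := by
    refine Matrix.IsHermitian.smul ?_ (IsSelfAdjoint.all _)
    simpa only [hZ.1.eq] using Matrix.isHermitian_mul_mul_conjTranspose Z hE'
  have key := (hasDerivAt_trace_mlog_sq hZM hH).const_mul (1 / 2 : ℝ)
  have hval : 1 / 2 * (2 * trace (mlog (Z * M * Z) * (Z * M * Z)⁻¹ * α i • (Z * E * Z))) =
      α i * trace (mlog (Z * M * Z) * (Z * M * Z)⁻¹ * Z * E * Z) := by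
    rw [mul_smul_comm, trace_smul, smul_eq_mul]
    simp only [mul_assoc]
    ring
  rw [hval] at key
  refine key.congr_of_eventuallyEq (Eventually.of_forall fun t => ?_)
  simp only [mul_add, add_mul, mul_smul_comm, smul_mul_assoc, mul_smul]
end
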